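/- Let k ≥ 2 and n_i ≥ 3 for 1 ≤ i ≤ k. Over the (k+1)-letter alphabet Σ = {b, a₁, …, a_k}, for each i let A_i be the DFA with state set Fin n_i, start state 0 and unique accepting state n_i−1, in which the letter a_i acts as the cyclic shift q ↦ q+1 (mod n_i), every letter a_j with j ≠ i acts as the identity, and the letter b maps 0 to 1 and fixes every other state. Then the minimal DFA for the concatenation L(A₁)L(A₂)⋯L(A_k) has exactly B(n₁,…,n_k) states: this concatenation is accepted by some DFA with B(n₁,…,n_k) states and by no DFA with fewer states. -/

import Mathlib

/-- Downward recursion with base `U = 2^{n_k}`, `V = 2^{n_k−1}` at the last index. -/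
def UV : List ℕ → ℕ × ℕ
  | [] => (1, 1)
  | [m] => (2 ^ m, 2 ^ (m - 1))
  | m :: rest =>
      (1 + (2 ^ (m - 1) - 1) * (UV rest).1 + 2 ^ (m - 1) * (UV rest).2,
       2 ^ (m - 2) * ((UV rest).1 + (UV rest).2))

/-- `B(n₁,…,n_k) = (n₁−1)·U₂ + V₂`, where `rest = [n₂,…,n_k]`. -/
def Bval (n1 : ℕ) (rest : List ℕ) : ℕ := (n1 - 1) * (UV rest).1 + (UV rest).2

/-- The witness DFA `Aᵢ` over the `(k+1)`-letter alphabet `Fin (k+1)`, where letter `0` is `b`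
and letter `i+1` is `aᵢ` (for `i : Fin k`): state set `Fin n`, start `0`, unique accepting
state `n−1`; `aᵢ` acts as the cyclic shift `q ↦ q+1 (mod n)`, each `a_j` with `j ≠ i` acts as
the identity, and `b` maps `0` to `1` and fixes every other state. -/
def witnessDFA (k : ℕ) {n : ℕ} (hn : 3 ≤ n) (i : Fin k) : DFA (Fin (k + 1)) (Fin n) :=
  haveI : NeZero n := ⟨by omega⟩
  { step := fun q c =>
      if c.val = i.val + 1 then q + 1
      else if c.val = 0 ∧ q.val = 0 then ⟨1, by omega⟩
      else q
    start := 0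
    accept := {⟨n - 1, by omega⟩} }

/-- A tuple of subsets `T i ⊆ {0, …, n i - 1}` for `i < k`, padded by empty sets, such that
emptiness propagates to the right and `n i - 1 ∈ T i` forces `0 ∈ T (i + 1)`. -/
structure ValidTuple (k : ℕ) (n : ℕ → ℕ) (T : ℕ → Finset ℕ) : Prop where
  eq_empty : ∀ i, k ≤ i → T i = ∅
  lt : ∀ i, ∀ x ∈ T i, x < n i
  chain : ∀ i, T i = ∅ → T (i + 1) = ∅
  zero_mem : ∀ i, i + 1 < k → n i - 1 ∈ T i → 0 ∈ T (i + 1)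

/-- Prepend a set to a sequence of sets. -/
def consSet (s : Finset ℕ) (T : ℕ → Finset ℕ) : ℕ → Finset ℕ
  | 0 => s
  | i + 1 => T i

theorem consSet_injective :
    Function.Injective (fun p : (_ : Finset ℕ) × (ℕ → Finset ℕ) => consSet p.1 p.2) := by
  rintro ⟨s, T⟩ ⟨s', T'⟩ h
  have h0 : s = s' := congrFun h 0
  have h1 : T = T' := funext fun i => congrFun h (i + 1)
  subst h0 h1
  rfl

theorem consSet_zero_succ (T : ℕ → Finset ℕ) : consSet (T 0) (fun i => T (i + 1)) = T := by
  funext i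
  cases i <;> rfl

theorem ValidTuple.eq_empty_of_zero {k : ℕ} {n : ℕ → ℕ} {T : ℕ → Finset ℕ}
    (hT : ValidTuple k n T) (h0 : T 0 = ∅) (i : ℕ) : T i = ∅ := by
  induction i with
  | zero => exact h0
  | succ i ih => exact hT.chain i ih

theorem validTuple_consSet {k : ℕ} {n : ℕ → ℕ} {s : Finset ℕ} {T : ℕ → Finset ℕ} :
    ValidTuple (k + 1) n (consSet s T) ↔
      s ⊆ Finset.range (n 0) ∧ ValidTuple k (fun i => n (i + 1)) T ∧
        (s = ∅ → T 0 = ∅) ∧ (n 0 - 1 ∈ s → k = 0 ∨ 0 ∈ T 0) := by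
  constructor
  · intro h
    refine ⟨fun x hx => Finset.mem_range.2 (h.lt 0 x hx),
      ⟨fun i hi => h.eq_empty (i + 1) (by omega), fun i => h.lt (i + 1),
        fun i => h.chain (i + 1), fun i hi => h.zero_mem (i + 1) (by omega)⟩,
      h.chain 0, fun hs => ?_⟩
    rcases Nat.eq_zero_or_pos k with hk | hk
    · exact Or.inl hk
    · exact Or.inr (h.zero_mem 0 (by omega) hs)
  · rintro ⟨hs, hT, h0, hl⟩
    refine ⟨fun i hi => ?_, fun i => ?_, fun i => ?_, fun i hi => ?_⟩
    · obtain ⟨j, rfl⟩ : ∃ j, i = j + 1 := ⟨i - 1, by omega⟩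
      exact hT.eq_empty j (by omega)
    · cases i with
      | zero => exact fun x hx => Finset.mem_range.1 (hs hx)
      | succ i => exact hT.lt i
    · cases i with
      | zero => exact h0
      | succ i => exact hT.chain i
    · cases i with
      | zero => exact fun h => (hl h).resolve_left (by omega)
      | succ i => exact hT.zero_mem i (by omega)

section Counting
open Classical

/-- All sequences `consSet s T` with `s ∈ A` and `T ∈ F` compatible with `s`. -/
noncomputable def extendTuples (k m : ℕ) (A : Finset (Finset ℕ)) (F : Finset (ℕ → Finset ℕ)) :
    Finset (ℕ → Finset ℕ) :=
  (A.sigma fun s => F.filter fun T =>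
    (s = ∅ → T 0 = ∅) ∧ (m - 1 ∈ s → k = 0 ∨ 0 ∈ T 0)).image fun p => consSet p.1 p.2

/-- The finite set of valid tuples. -/
noncomputable def validTuples : ℕ → (ℕ → ℕ) → Finset (ℕ → Finset ℕ)
  | 0, _ => {fun _ => ∅}
  | k + 1, n =>
    extendTuples k (n 0) (Finset.range (n 0)).powerset (validTuples k fun i => n (i + 1))

theorem mem_extendTuples {k m : ℕ} {A : Finset (Finset ℕ)} {F : Finset (ℕ → Finset ℕ)}
    {T : ℕ → Finset ℕ} :
    T ∈ extendTuples k m A F ↔ T 0 ∈ A ∧ (fun i => T (i + 1)) ∈ F ∧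
      (T 0 = ∅ → T 1 = ∅) ∧ (m - 1 ∈ T 0 → k = 0 ∨ 0 ∈ T 1) := by
  unfold extendTuples
  simp only [Finset.mem_image, Finset.mem_sigma, Finset.mem_filter]
  constructor
  · rintro ⟨p, h, rfl⟩
    exact h
  · intro h
    exact ⟨⟨T 0, fun i => T (i + 1)⟩, h, consSet_zero_succ T⟩

theorem mem_validTuples {k : ℕ} {n : ℕ → ℕ} {T : ℕ → Finset ℕ} :
    T ∈ validTuples k n ↔ ValidTuple k n T := by
  induction k generalizing n T with
  | zero =>
    simp only [validTuples, Finset.mem_singleton]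
    constructor
    · rintro rfl
      exact ⟨by simp, by simp, by simp, by simp⟩
    · exact fun h => funext fun i => h.eq_empty i (Nat.zero_le i)
  | succ k ih =>
    rw [← consSet_zero_succ T, validTuple_consSet, validTuples, mem_extendTuples, ih,
      Finset.mem_powerset]
    rfl

theorem card_extendTuples {k m : ℕ} {n : ℕ → ℕ} {A : Finset (Finset ℕ)} :
    (extendTuples k m A (validTuples k n)).card = ∑ s ∈ A,
      if s = ∅ then 1 else if m - 1 ∈ s then
        ((validTuples k n).filter fun T => k = 0 ∨ 0 ∈ T 0).card else (validTuples k n).card := by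
  unfold extendTuples
  rw [Finset.card_image_of_injective _ consSet_injective, Finset.card_sigma]
  refine Finset.sum_congr rfl fun s _ => ?_
  split_ifs with h1 h2
  · rw [Finset.card_eq_one]
    refine ⟨fun _ => ∅, Finset.ext fun T => ?_⟩
    simp only [Finset.mem_filter, mem_validTuples, Finset.mem_singleton]
    constructor
    · rintro ⟨hT, h0, _⟩
      exact funext (hT.eq_empty_of_zero (h0 h1))
    · rintro rfl
      refine ⟨⟨by simp, by simp, by simp, by simp⟩, by simp, by simp [h1]⟩
  · simp [h1, h2]
  · simp [h1, h2]

theorem card_validTuples_succ {k : ℕ} {n : ℕ → ℕ} (hn : 3 ≤ n 0) :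
    (validTuples (k + 1) n).card = 1 +
      (2 ^ (n 0 - 1) - 1) * (validTuples k fun i => n (i + 1)).card +
      2 ^ (n 0 - 1) *
        ((validTuples k fun i => n (i + 1)).filter fun T => k = 0 ∨ 0 ∈ T 0).card := by
  obtain ⟨m, hm⟩ : ∃ m, n 0 = m + 1 := ⟨n 0 - 1, by omega⟩
  rw [validTuples, card_extendTuples, hm, Finset.range_add_one,
    Finset.sum_powerset_insert Finset.notMem_range_self]
  congr 1
  · rw [← Finset.sum_erase_add _ _ (Finset.empty_mem_powerset (Finset.range m)), add_comm,
      if_pos rfl, Nat.add_sub_cancel]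
    congr 1
    rw [Finset.sum_congr rfl (g := fun _ => (validTuples k fun i => n (i + 1)).card),
      Finset.sum_const, Finset.card_erase_of_mem (by simp), Finset.card_powerset,
      Finset.card_range, smul_eq_mul]
    intro s hs
    simp only [Finset.mem_erase, Finset.mem_powerset] at hs
    rw [if_neg hs.1, if_neg fun h => Finset.notMem_range_self (hs.2 h)]
  · simp

theorem card_validTuples_filter_succ {k : ℕ} {n : ℕ → ℕ} (hn : 3 ≤ n 0) :
    ((validTuples (k + 1) n).filter fun T => k + 1 = 0 ∨ 0 ∈ T 0).card =
      2 ^ (n 0 - 2) * ((validTuples k fun i => n (i + 1)).card +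
        ((validTuples k fun i => n (i + 1)).filter fun T => k = 0 ∨ 0 ∈ T 0).card) := by
  have h1 : (validTuples (k + 1) n).filter (fun T => k + 1 = 0 ∨ 0 ∈ T 0) =
      extendTuples k (n 0) ((Finset.range (n 0)).powerset.filter fun s => 0 ∈ s)
        (validTuples k fun i => n (i + 1)) := by
    ext T
    simp only [validTuples, Finset.mem_filter, mem_extendTuples]
    simp
    tauto
  obtain ⟨m, hm⟩ : ∃ m, n 0 = m + 2 := ⟨n 0 - 2, by omega⟩
  have hR : Finset.range (m + 2) = insert (m + 1) (insert 0 (Finset.Ioo 0 (m + 1))) := by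
    ext x
    simp
    omega
  rw [h1, card_extendTuples, Finset.sum_filter, hm, hR,
    Finset.sum_powerset_insert (by simp), Finset.sum_powerset_insert (by simp),
    Finset.sum_powerset_insert (by simp)]
  have h0 : ∀ s ∈ (Finset.Ioo 0 (m + 1)).powerset, 0 ∉ s ∧ m + 1 ∉ s := by
    intro s hs
    rw [Finset.mem_powerset] at hs
    exact ⟨fun h => by simpa using hs h, fun h => by simpa using hs h⟩
  have e1 : ∀ (f g : Finset ℕ → ℕ), (∀ s, 0 ∉ s → m + 1 ∉ s → f s = g s) →
      ∑ s ∈ (Finset.Ioo 0 (m + 1)).powerset, f s =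
        ∑ s ∈ (Finset.Ioo 0 (m + 1)).powerset, g s :=
    fun f g h => Finset.sum_congr rfl fun s hs => h s (h0 s hs).1 (h0 s hs).2
  refine (congrArg₂ (· + ·)
    (congrArg₂ (· + ·) (e1 _ (fun _ => 0) fun s h2 h3 => by simp [h2])
      (e1 _ (fun _ => (validTuples k fun i => n (i + 1)).card) fun s h2 h3 => by simp [h3]))
    (congrArg₂ (· + ·) (e1 _ (fun _ => 0) fun s h2 h3 => by simp [h2])
      (e1 _ (fun _ => ((validTuples k fun i => n (i + 1)).filter
        fun T => k = 0 ∨ 0 ∈ T 0).card) fun s h2 h3 => by simp))).trans ?_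
  simp
  ring

theorem UV_cons {m : ℕ} (hm : 2 ≤ m) (r : List ℕ) :
    UV (m :: r) = (1 + (2 ^ (m - 1) - 1) * (UV r).1 + 2 ^ (m - 1) * (UV r).2,
       2 ^ (m - 2) * ((UV r).1 + (UV r).2)) := by
  cases r with
  | cons a r => rfl
  | nil =>
    obtain ⟨m, rfl⟩ : ∃ p, m = p + 2 := ⟨m - 2, by omega⟩
    have := Nat.one_le_two_pow (n := m + 1)
    simp only [UV, Prod.mk.injEq, Nat.add_sub_cancel, show m + 2 - 1 = m + 1 from rfl]
    constructor
    · simp only [pow_succ] at *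
      omega
    · simp only [pow_succ] at *

theorem card_validTuples (k : ℕ) (n : ℕ → ℕ) (hn : ∀ i, 3 ≤ n i) :
    (validTuples k n).card = (UV (List.ofFn fun i : Fin k => n i)).1 ∧
    ((validTuples k n).filter fun T => k = 0 ∨ 0 ∈ T 0).card =
      (UV (List.ofFn fun i : Fin k => n i)).2 := by
  induction k generalizing n with
  | zero => simp [validTuples, UV]
  | succ k ih =>
    obtain ⟨h1, h2⟩ := ih (fun i => n (i + 1)) fun i => hn _
    rw [card_validTuples_succ (hn 0), card_validTuples_filter_succ (hn 0), h1, h2,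
      List.ofFn_succ, UV_cons (by simpa using (hn 0).trans' (by norm_num))]
    simp

/-- The valid tuples whose first set is a singleton. -/
noncomputable def stateTuples (k : ℕ) (n : ℕ → ℕ) : Finset (ℕ → Finset ℕ) :=
  extendTuples k (n 0) ((Finset.range (n 0)).image fun q => {q})
    (validTuples k fun i => n (i + 1))

theorem mem_stateTuples {k : ℕ} {n : ℕ → ℕ} {T : ℕ → Finset ℕ} :
    T ∈ stateTuples k n ↔ ValidTuple (k + 1) n T ∧ ∃ q, T 0 = {q} := by
  rw [← mem_validTuples, validTuples, stateTuples, mem_extendTuples, mem_extendTuples]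
  simp only [Finset.mem_image, Finset.mem_powerset, Finset.mem_range]
  constructor
  · rintro ⟨⟨q, hq, h⟩, h'⟩
    exact ⟨⟨by simpa [← h], h'⟩, q, h.symm⟩
  · rintro ⟨⟨h, h'⟩, q, hq⟩
    exact ⟨⟨q, by simpa [hq] using h, hq.symm⟩, h'⟩

theorem card_stateTuples (k : ℕ) (n : ℕ → ℕ) (hn : ∀ i, 3 ≤ n i) :
    (stateTuples k n).card = Bval (n 0) (List.ofFn fun i : Fin k => n (i + 1)) := by
  obtain ⟨h1, h2⟩ := card_validTuples k (fun i => n (i + 1)) fun i => hn _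
  obtain ⟨m, hm⟩ : ∃ m, n 0 = m + 1 := ⟨n 0 - 1, by have := hn 0; omega⟩
  rw [stateTuples, card_extendTuples, h1, h2,
    Finset.sum_image fun _ _ _ _ h => Finset.singleton_injective h, hm,
    Finset.sum_range_succ, Finset.sum_congr rfl (g := fun _ =>
      (UV (List.ofFn fun i : Fin k => n (i + 1))).1)]
  · simp [Bval]
  · intro q hq
    have := Finset.mem_range.1 hq
    simp
    omega

end Counting

/-- The action of letter `c` on state `q` of the `i`-th witness automaton with `m` states. -/
def letterAct (m i c q : ℕ) : ℕ :=
  if c = i + 1 then (if q + 1 = m then 0 else q + 1) else if c = 0 ∧ q = 0 then 1 else q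

theorem letterAct_lt {m i c q : ℕ} (hm : 3 ≤ m) (hq : q < m) : letterAct m i c q < m := by
  unfold letterAct
  split_ifs <;> omega

/-- The subset automaton of the concatenation, acting on tuples of sets of states. -/
def tupleStep (k : ℕ) (n : ℕ → ℕ) (T : ℕ → Finset ℕ) (c : ℕ) : ℕ → Finset ℕ
  | 0 => (T 0).image (letterAct (n 0) 0 c)
  | i + 1 =>
    if i + 1 < k then
      (T (i + 1)).image (letterAct (n (i + 1)) (i + 1) c) ∪
        (if n i - 1 ∈ tupleStep k n T c i then {0} else ∅)
    else ∅

/-- The initial tuple `({0}, ∅, ∅, …)`. -/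
def tupleStart : ℕ → Finset ℕ
  | 0 => {0}
  | _ + 1 => ∅

/-- The tuple reached from `T` by reading a word. -/
def tupleRun (k : ℕ) (n : ℕ → ℕ) (T : ℕ → Finset ℕ) (w : List (Fin (k + 1))) : ℕ → Finset ℕ :=
  w.foldl (fun S c => tupleStep k n S c.val) T

theorem mem_tupleStep_zero {k : ℕ} {n : ℕ → ℕ} {T : ℕ → Finset ℕ} {c x : ℕ} :
    x ∈ tupleStep k n T c 0 ↔ ∃ y ∈ T 0, letterAct (n 0) 0 c y = x := by
  simp [tupleStep]

theorem mem_tupleStep_succ {k : ℕ} {n : ℕ → ℕ} {T : ℕ → Finset ℕ} {c i x : ℕ} :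
    x ∈ tupleStep k n T c (i + 1) ↔ i + 1 < k ∧
      ((∃ y ∈ T (i + 1), letterAct (n (i + 1)) (i + 1) c y = x) ∨
        (x = 0 ∧ n i - 1 ∈ tupleStep k n T c i)) := by
  rw [tupleStep]
  by_cases h1 : i + 1 < k
  · by_cases h2 : n i - 1 ∈ tupleStep k n T c i <;> simp [h1, h2, or_comm]
  · simp [h1]

theorem ValidTuple.tupleStep {k : ℕ} {n : ℕ → ℕ} {T : ℕ → Finset ℕ} (hn : ∀ i, 3 ≤ n i)
    (hk : 0 < k) (hT : ValidTuple k n T) (c : ℕ) : ValidTuple k n (tupleStep k n T c) := by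
  refine ⟨fun i hi => ?_, fun i x hx => ?_, fun i hi => ?_, fun i hi h => ?_⟩
  · obtain ⟨j, rfl⟩ : ∃ j, i = j + 1 := ⟨i - 1, by omega⟩
    rw [_root_.tupleStep, if_neg (by omega)]
  · cases i with
    | zero =>
      obtain ⟨y, hy, rfl⟩ := mem_tupleStep_zero.1 hx
      exact letterAct_lt (hn _) (hT.lt _ _ hy)
    | succ i =>
      obtain ⟨_, ⟨y, hy, rfl⟩ | ⟨rfl, _⟩⟩ := mem_tupleStep_succ.1 hx
      · exact letterAct_lt (hn _) (hT.lt _ _ hy)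
      · have := hn (i + 1)
        omega
  · have h0 : T i = ∅ := by
      by_contra hne
      obtain ⟨y, hy⟩ := Finset.nonempty_iff_ne_empty.2 hne
      refine Finset.notMem_empty (letterAct (n i) i c y) (hi ▸ ?_)
      cases i with
      | zero => exact mem_tupleStep_zero.2 ⟨y, hy, rfl⟩
      | succ i =>
        refine mem_tupleStep_succ.2 ⟨?_, Or.inl ⟨y, hy, rfl⟩⟩
        by_contra h
        simp [hT.eq_empty (i + 1) (by omega)] at hy
    rw [Finset.eq_empty_iff_forall_notMem]
    intro x hx
    obtain ⟨_, ⟨y, hy, rfl⟩ | ⟨rfl, h⟩⟩ := mem_tupleStep_succ.1 hx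
    · simp [hT.chain i h0] at hy
    · simp [hi] at h
  · exact mem_tupleStep_succ.2 ⟨hi, Or.inr ⟨rfl, h⟩⟩

theorem validTuple_tupleStart {k : ℕ} {n : ℕ → ℕ} (hn : ∀ i, 3 ≤ n i) (hk : 0 < k) :
    ValidTuple k n tupleStart := by
  refine ⟨fun i hi => ?_, fun i x hx => ?_, fun i _ => rfl, fun i hi h => ?_⟩
  · obtain ⟨j, rfl⟩ : ∃ j, i = j + 1 := ⟨i - 1, by omega⟩
    rfl
  · cases i with
    | zero =>
      have := hn 0
      simp only [tupleStart, Finset.mem_singleton] at hx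
      omega
    | succ i => simp [tupleStart] at hx
  · cases i with
    | zero =>
      have := hn 0
      simp only [tupleStart, Finset.mem_singleton] at h
      omega
    | succ i => simp [tupleStart] at h

theorem tupleRun_start_valid {k : ℕ} {n : ℕ → ℕ} (hn : ∀ i, 3 ≤ n i) (hk : 0 < k)
    (w : List (Fin (k + 1))) :
    ValidTuple k n (tupleRun k n tupleStart w) ∧ ∃ q, tupleRun k n tupleStart w 0 = {q} := by
  induction w using List.reverseRecOn with
  | nil => exact ⟨validTuple_tupleStart hn hk, 0, rfl⟩
  | append_singleton w c ih =>
    obtain ⟨h, q, hq⟩ := ih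
    rw [tupleRun, List.foldl_append]
    refine ⟨h.tupleStep hn hk c.val, letterAct (n 0) 0 c.val q, ?_⟩
    change tupleStep k n (tupleRun k n tupleStart w) c.val 0 = _
    rw [tupleStep, hq, Finset.image_singleton]

/-- The cyclic shift on subsets of `{0, …, m - 1}`. -/
def cycShift (m : ℕ) (s : Finset ℕ) : Finset ℕ :=
  s.image fun q => if q + 1 = m then 0 else q + 1

theorem iterate_cycShift {m : ℕ} {s : Finset ℕ} (hs : ∀ x ∈ s, x < m) (t : ℕ) :
    (cycShift m)^[t] s = s.image fun y => (y + t) % m := by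
  induction t with
  | zero =>
    rw [Function.iterate_zero, id, Finset.image_congr (g := id), Finset.image_id]
    exact fun x hx => Nat.mod_eq_of_lt (hs x hx)
  | succ t ih =>
    rw [Function.iterate_succ_apply', ih, cycShift, Finset.image_image]
    refine Finset.image_congr fun x hx => ?_
    have hm : (x + t) % m < m := Nat.mod_lt _ ((Nat.zero_le x).trans_lt (hs x hx))
    simp only [Function.comp]
    rw [← add_assoc, ← Nat.mod_add_mod (x + t) m 1]
    split_ifs with h
    · rw [h, Nat.mod_self]
    · exact (Nat.mod_eq_of_lt (by omega)).symm

section Shift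
variable {k : ℕ} {n : ℕ → ℕ} {T : ℕ → Finset ℕ} {i : ℕ}

theorem tupleStep_shift_of_lt (hT : ValidTuple k n T) (hi : i < k) (j : ℕ) (hj : j < i) :
    tupleStep k n T (i + 1) j = T j := by
  induction j with
  | zero =>
    ext x
    rw [mem_tupleStep_zero]
    have : i ≠ 0 := by omega
    simp [letterAct, this]
  | succ j ih =>
    ext x
    rw [mem_tupleStep_succ, ih (by omega)]
    have : i ≠ j + 1 := by omega
    have hz := hT.zero_mem j (by omega)
    simp only [letterAct, Nat.add_right_cancel_iff, this, if_false, Nat.succ_ne_zero, false_and,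
      exists_eq_right]
    constructor
    · rintro ⟨_, h | ⟨rfl, h⟩⟩
      exacts [h, hz h]
    · exact fun h => ⟨by omega, Or.inl h⟩

theorem tupleStep_shift_self (hT : ValidTuple k n T) (hi : i < k)
    (hp : ∀ j, j + 1 = i → n j - 1 ∉ T j) :
    tupleStep k n T (i + 1) i = cycShift (n i) (T i) := by
  cases i with
  | zero => ext x; simp [tupleStep, letterAct, cycShift]
  | succ i =>
    ext x
    rw [mem_tupleStep_succ, tupleStep_shift_of_lt hT hi i (by omega)]
    simp [letterAct, cycShift, hi, hp i rfl]

theorem mem_tupleStep_shift_succ (hT : ValidTuple k n T) (hi : i < k)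
    (hp : ∀ j, j + 1 = i → n j - 1 ∉ T j) (x : ℕ) :
    x ∈ tupleStep k n T (i + 1) (i + 1) ↔
      x ∈ T (i + 1) ∨ (x = 0 ∧ i + 1 < k ∧ n i - 1 ∈ cycShift (n i) (T i)) := by
  rw [mem_tupleStep_succ, tupleStep_shift_self hT hi hp]
  by_cases h : i + 1 < k
  · simp [letterAct, h]
  · simp [h, hT.eq_empty (i + 1) (by omega)]

theorem tupleStep_shift_of_gt (hn : ∀ i, 3 ≤ n i) (hT : ValidTuple k n T) (hi : i < k)
    (hp : ∀ j, j + 1 = i → n j - 1 ∉ T j) (j : ℕ) (hj : i + 1 < j) :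
    tupleStep k n T (i + 1) j = T j := by
  induction j, hj using Nat.le_induction with
  | base =>
    ext x
    rw [mem_tupleStep_succ, mem_tupleStep_shift_succ hT hi hp]
    have h3 : n (i + 1) - 1 ≠ 0 := by have := hn (i + 1); omega
    by_cases h : i + 1 + 1 < k
    · have hz := hT.zero_mem (i + 1) h
      simp only [letterAct, h3, h, false_and, or_false, true_and]
      simp
      rintro rfl h'
      exact hz h'
    · simp [h, hT.eq_empty (i + 1 + 1) (by omega)]
  | succ j hj ih =>
    ext x
    rw [mem_tupleStep_succ, ih]
    by_cases h : j + 1 < k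
    · have hz := hT.zero_mem j h
      have : i ≠ j + 1 := by omega
      simp [letterAct, h, this]
      rintro rfl h'
      exact hz h'
    · simp [h, hT.eq_empty (j + 1) (by omega)]

/-- The tuples reached from the initial tuple by reading words. -/
def TupleReachable (k : ℕ) (n : ℕ → ℕ) (T : ℕ → Finset ℕ) : Prop :=
  ∃ w, tupleRun k n tupleStart w = T

theorem TupleReachable.step (hT : TupleReachable k n T) {c : ℕ} (hc : c < k + 1) :
    TupleReachable k n (tupleStep k n T c) := by
  obtain ⟨w, rfl⟩ := hT
  exact ⟨w ++ [⟨c, hc⟩], by simp [tupleRun]⟩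

theorem TupleReachable.valid (hn : ∀ i, 3 ≤ n i) (hk : 0 < k) (hT : TupleReachable k n T) :
    ValidTuple k n T := by
  obtain ⟨w, rfl⟩ := hT
  exact (tupleRun_start_valid hn hk w).1

theorem TupleReachable.shift (hn : ∀ i, 3 ≤ n i) (hT : TupleReachable k n T) (hi : i < k)
    (hp : ∀ j, j + 1 = i → n j - 1 ∉ T j) :
    TupleReachable k n (Function.update (Function.update T i (cycShift (n i) (T i))) (i + 1)
      (if i + 1 < k ∧ n i - 1 ∈ cycShift (n i) (T i) then insert 0 (T (i + 1))
        else T (i + 1))) := by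
  have hv := hT.valid hn (by omega)
  convert hT.step (c := i + 1) (by omega) using 1
  funext j
  rcases lt_trichotomy j i with h | rfl | h
  · rw [tupleStep_shift_of_lt hv hi j h, Function.update_of_ne (by omega),
      Function.update_of_ne (by omega)]
  · rw [tupleStep_shift_self hv hi hp, Function.update_of_ne (by omega), Function.update_self]
  · rcases eq_or_lt_of_le (Nat.succ_le_of_lt h) with rfl | h
    · ext x
      rw [Nat.succ_eq_add_one, mem_tupleStep_shift_succ hv hi hp, Function.update_self]
      split_ifs with h'
      · simp [h', or_comm]
      · simp [h']
    · rw [tupleStep_shift_of_gt hn hv hi hp j h, Function.update_of_ne (by omega),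
        Function.update_of_ne (by omega)]

theorem TupleReachable.update_cycShift (hn : ∀ i, 3 ≤ n i) (hT : TupleReachable k n T)
    (hi : i < k) (hp : ∀ j, j + 1 = i → n j - 1 ∉ T j)
    (hl : i + 1 < k → n i - 1 ∈ cycShift (n i) (T i) → 0 ∈ T (i + 1)) :
    TupleReachable k n (Function.update T i (cycShift (n i) (T i))) := by
  convert hT.shift hn hi hp using 1
  rw [eq_comm, Function.update_eq_self_iff, Function.update_of_ne (by omega)]
  split_ifs with h
  · exact Finset.insert_eq_of_mem (hl h.1 h.2)
  · rfl

theorem TupleReachable.iterate_shift (hn : ∀ i, 3 ≤ n i) (hT : TupleReachable k n T)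
    (hi : i + 1 < k) (hp : ∀ j, j + 1 = i → n j - 1 ∉ T j) (t : ℕ) :
    ∃ W, (W = T (i + 1) ∨ W = insert 0 (T (i + 1))) ∧
      ((∃ r < t, n i - 1 ∈ (cycShift (n i))^[r + 1] (T i)) → W = insert 0 (T (i + 1))) ∧
      TupleReachable k n
        (Function.update (Function.update T i ((cycShift (n i))^[t] (T i))) (i + 1) W) := by
  induction t with
  | zero => exact ⟨T (i + 1), Or.inl rfl, by simp, by simpa⟩
  | succ t ih =>
    obtain ⟨W, hW, hW', hR⟩ := ih
    have h := hR.shift hn (i := i) (by omega) fun j hj => by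
      rw [Function.update_of_ne (by omega), Function.update_of_ne (by omega)]
      exact hp j hj
    rw [Function.update_self, Function.update_of_ne (by omega), Function.update_self,
      ← Function.iterate_succ_apply' (cycShift (n i)), Function.update_comm (by omega),
      Function.update_idem, Function.update_comm (by omega), Function.update_idem] at h
    refine ⟨_, ?_, ?_, h⟩
    · split_ifs
      · rcases hW with rfl | rfl <;> simp
      · exact hW
    · rintro ⟨r, hr, hr'⟩
      rcases Nat.lt_succ_iff_lt_or_eq.1 hr with hr | rfl
      · rw [hW' ⟨r, hr, hr'⟩]
        simp
      · rw [if_pos ⟨hi, hr'⟩]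
        rcases hW with rfl | rfl <;> simp

theorem TupleReachable.insert_zero (hn : ∀ i, 3 ≤ n i) (hT : TupleReachable k n T)
    (hi : i + 1 < k) (hp : ∀ j, j + 1 = i → n j - 1 ∉ T j) (hne : (T i).Nonempty) :
    TupleReachable k n (Function.update T (i + 1) (insert 0 (T (i + 1)))) := by
  have hlt := (hT.valid hn (by omega)).lt i
  obtain ⟨W, -, hW, h⟩ := hT.iterate_shift hn hi hp (n i)
  obtain ⟨y, hy⟩ := hne
  have hy' := hlt y hy
  rw [hW, iterate_cycShift hlt, Finset.image_congr (g := id), Finset.image_id,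
    Function.update_eq_self] at h
  · exact h
  · intro x hx
    simpa using Nat.mod_eq_of_lt (hlt x hx)
  · by_cases hl : y + 1 = n i
    · refine ⟨n i - 1, by omega, ?_⟩
      rw [iterate_cycShift hlt, Finset.mem_image]
      refine ⟨y, hy, ?_⟩
      rw [show y + (n i - 1 + 1) = n i - 1 + n i by omega, Nat.add_mod_right,
        Nat.mod_eq_of_lt (by omega)]
    · refine ⟨n i - 2 - y, by omega, ?_⟩
      rw [iterate_cycShift hlt, Finset.mem_image]
      refine ⟨y, hy, ?_⟩
      rw [show y + (n i - 2 - y + 1) = n i - 1 by omega, Nat.mod_eq_of_lt (by omega)]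

end Shift

section Reachability
variable {k : ℕ} {n : ℕ → ℕ} {T : ℕ → Finset ℕ}

/-- A weight that decreases when a set is shifted down or loses an element. -/
def tupleWeight (k : ℕ) (T : ℕ → Finset ℕ) : ℕ :=
  ∑ i ∈ Finset.range k, ∑ x ∈ T i, (x + 1)

theorem tupleWeight_update_lt {i : ℕ} {s : Finset ℕ} (hi : i < k)
    (hs : ∑ x ∈ s, (x + 1) < ∑ x ∈ T i, (x + 1)) :
    tupleWeight k (Function.update T i s) < tupleWeight k T := by
  refine Finset.sum_lt_sum (fun j _ => ?_) ⟨i, Finset.mem_range.2 hi, by simpa using hs⟩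
  rcases eq_or_ne j i with rfl | h
  · simpa using hs.le
  · simp [h]

/-- Every valid tuple of smaller weight with a singleton in front is reachable. -/
def ReachableBelow (k : ℕ) (n : ℕ → ℕ) (T : ℕ → Finset ℕ) : Prop :=
  ∀ S, tupleWeight k S < tupleWeight k T → ValidTuple k n S → (∃ q, S 0 = {q}) →
    TupleReachable k n S

theorem ReachableBelow.of_zero_notMem (hn : ∀ i, 3 ≤ n i) (ih : ReachableBelow k n T)
    (hT : ValidTuple k n T) (h0 : ∃ q, T 0 = {q}) {i : ℕ} (hi : i < k)
    (hp : ∀ j, j + 1 = i → n j - 1 ∉ T j) (hz : 0 ∉ T i) (hne : (T i).Nonempty) :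
    TupleReachable k n T := by
  set s := (T i).image fun x => x - 1 with hs
  have hpos : ∀ x ∈ T i, x ≠ 0 := fun x hx h => hz (h ▸ hx)
  have hs1 : cycShift (n i) s = T i := by
    rw [cycShift, hs, Finset.image_image, Finset.image_congr (g := id), Finset.image_id]
    intro x hx
    have h1 := hpos x hx
    have h2 := hT.lt i x hx
    simp only [Function.comp, id]
    rw [if_neg (by omega)]
    omega
  have hv : ValidTuple k n (Function.update T i s) := by
    refine ⟨fun j hj => ?_, fun j x => ?_, fun j => ?_, fun j hj => ?_⟩
    · rw [Function.update_of_ne (by omega)]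
      exact hT.eq_empty j hj
    · rcases eq_or_ne j i with rfl | h
      · rw [Function.update_self, hs, Finset.mem_image]
        rintro ⟨y, hy, rfl⟩
        have := hT.lt j y hy
        omega
      · rw [Function.update_of_ne h]
        exact hT.lt j x
    · have hse : s = ∅ ↔ T i = ∅ := by simp [hs]
      rcases eq_or_ne j i with rfl | h
      · rw [Function.update_self, Function.update_of_ne (by omega), hse]
        exact hT.chain j
      · rw [Function.update_of_ne h]
        rcases eq_or_ne (j + 1) i with rfl | h'
        · rw [Function.update_self, hse]
          exact hT.chain j
        · rw [Function.update_of_ne h']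
          exact hT.chain j
    · rcases eq_or_ne j i with rfl | h
      · rw [Function.update_self, hs, Finset.mem_image]
        rintro ⟨y, hy, h⟩
        have := hT.lt j y hy
        have := hpos y hy
        have := hn j
        omega
      · rw [Function.update_of_ne h]
        rcases eq_or_ne (j + 1) i with rfl | h'
        · exact fun h => absurd h (hp j rfl)
        · rw [Function.update_of_ne h']
          exact hT.zero_mem j hj
  have hr := ih (Function.update T i s) (tupleWeight_update_lt hi ?_) hv ?_
  · have := hr.update_cycShift hn hi (fun j hj => ?_) ?_
    · rw [Function.update_self, hs1, Function.update_idem, Function.update_eq_self] at this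
      exact this
    · rw [Function.update_of_ne (by omega)]
      exact hp j hj
    · rw [Function.update_self, Function.update_of_ne (by omega), hs1]
      exact hT.zero_mem i
  · rw [hs, Finset.sum_image]
    · refine Finset.sum_lt_sum_of_nonempty hne fun x hx => ?_
      have := hpos x hx
      omega
    · intro x hx y hy hxy
      have := hpos x hx
      have := hpos y hy
      simp only at hxy
      omega
  · obtain ⟨q, hq⟩ := h0
    rcases eq_or_ne 0 i with rfl | h
    · exact ⟨q - 1, by simp [hs, hq]⟩
    · exact ⟨q, by rwa [Function.update_of_ne h]⟩

theorem ReachableBelow.of_zero_mem (hn : ∀ i, 3 ≤ n i) (ih : ReachableBelow k n T)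
    (hT : ValidTuple k n T) (h0 : ∃ q, T 0 = {q}) {i : ℕ} (hi : i + 1 < k)
    (hp : ∀ j, j + 1 = i → n j - 1 ∉ T j) (hp' : n i - 1 ∉ T i) (hne : (T i).Nonempty)
    (hz : 0 ∈ T (i + 1)) (he : (T (i + 1)).erase 0 = ∅ → T (i + 2) = ∅) :
    TupleReachable k n T := by
  have hv : ValidTuple k n (Function.update T (i + 1) ((T (i + 1)).erase 0)) := by
    refine ⟨fun j hj => ?_, fun j x => ?_, fun j => ?_, fun j hj => ?_⟩
    · rw [Function.update_of_ne (by omega)]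
      exact hT.eq_empty j hj
    · rcases eq_or_ne j (i + 1) with rfl | h
      · rw [Function.update_self]
        exact fun h => hT.lt _ x (Finset.mem_of_mem_erase h)
      · rw [Function.update_of_ne h]
        exact hT.lt j x
    · rcases eq_or_ne j (i + 1) with rfl | h
      · rw [Function.update_self, Function.update_of_ne (by omega)]
        exact he
      · rw [Function.update_of_ne h]
        rcases eq_or_ne j i with rfl | h'
        · exact fun h => absurd h hne.ne_empty
        · rw [Function.update_of_ne (by omega)]
          exact hT.chain j
    · rcases eq_or_ne j (i + 1) with rfl | h
      · rw [Function.update_self, Function.update_of_ne (by omega)]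
        exact fun h => hT.zero_mem _ hj (Finset.mem_of_mem_erase h)
      · rw [Function.update_of_ne h]
        rcases eq_or_ne j i with rfl | h'
        · exact fun h => absurd h hp'
        · rw [Function.update_of_ne (by omega)]
          exact hT.zero_mem j hj
  have hr := ih _ (tupleWeight_update_lt hi ?_) hv ?_
  · have := hr.insert_zero hn hi (fun j hj => ?_) ?_
    · rw [Function.update_self, Finset.insert_erase hz, Function.update_idem,
        Function.update_eq_self] at this
      exact this
    · rw [Function.update_of_ne (by omega)]
      exact hp j hj
    · rwa [Function.update_of_ne (by omega)]
  · rw [← Finset.sum_erase_add _ _ hz]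
    omega
  · rwa [Function.update_of_ne (by omega)]

theorem ReachableBelow.of_succ (hn : ∀ i, 3 ≤ n i) (ih : ReachableBelow k n T)
    (hT : ValidTuple k n T) (h0 : ∃ q, T 0 = {q}) {i : ℕ} (hi : i + 1 < k)
    (hp : ∀ j ≤ i, n j - 1 ∉ T j) (hne : (T (i + 1)).Nonempty)
    (he : n (i + 1) - 1 ∈ T (i + 1) ∨ T (i + 2) = ∅) : TupleReachable k n T := by
  by_cases hz : 0 ∈ T (i + 1)
  · refine ih.of_zero_mem hn hT h0 hi (fun j hj => hp j (by omega)) (hp i le_rfl) ?_ hz ?_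
    · exact Finset.nonempty_iff_ne_empty.2 fun h => hne.ne_empty (hT.chain i h)
    · intro h
      refine he.resolve_left fun h' => ?_
      have h3 := hn (i + 1)
      exact Finset.notMem_empty (n (i + 1) - 1) (h ▸ Finset.mem_erase.2 ⟨by omega, h'⟩)
  · exact ih.of_zero_notMem hn hT h0 hi (fun j hj => hp j (by omega)) hz hne

theorem ValidTuple.reachable (hn : ∀ i, 3 ≤ n i) (hk : 0 < k) (hT : ValidTuple k n T)
    (h0 : ∃ q, T 0 = {q}) : TupleReachable k n T := by
  induction hM : tupleWeight k T using Nat.strong_induction_on generalizing T with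
  | _ M IH =>
    have ih : ReachableBelow k n T := fun S hS hv hq => IH _ (hM ▸ hS) hv hq rfl
    have h1 : (T 0).Nonempty := by
      obtain ⟨q, hq⟩ := h0
      simp [hq]
    by_cases hz : 0 ∈ T 0
    · have hl0 : n 0 - 1 ∉ T 0 := by
        obtain ⟨q, hq⟩ := h0
        have := hn 0
        rw [hq, Finset.mem_singleton] at hz ⊢
        omega
      by_cases hl : ∃ i, n i - 1 ∈ T i
      · classical
        have hs := Nat.find_spec hl
        have hmin := fun j => Nat.find_min hl (m := j)
        generalize Nat.find hl = i at hs hmin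
        cases i with
        | zero => exact absurd hs hl0
        | succ i =>
          refine ih.of_succ hn hT h0 ?_ (fun j hj => hmin j (by omega)) ⟨_, hs⟩ (Or.inl hs)
          by_contra h
          simp [hT.eq_empty (i + 1) (by omega)] at hs
      · push Not at hl
        have hex : ∃ i, T i = ∅ := ⟨k, hT.eq_empty k le_rfl⟩
        have hs := Nat.find_spec hex
        have hmin := fun j => Nat.find_min hex (m := j)
        generalize Nat.find hex = i at hs hmin
        match i with
        | 0 => exact absurd hs h1.ne_empty
        | 1 =>
          refine ⟨[], funext fun j => ?_⟩
          cases j with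
          | zero =>
            obtain ⟨q, hq⟩ := h0
            rw [hq, Finset.mem_singleton] at hz
            rw [hq, ← hz]
            rfl
          | succ j =>
            induction j with
            | zero => exact hs.symm
            | succ j ih => exact (hT.chain _ ih.symm).symm
        | i + 2 =>
          have hne := hmin (i + 1) (by omega)
          refine ih.of_succ hn hT h0 ?_ (fun j _ => hl j)
            (Finset.nonempty_iff_ne_empty.2 hne) (Or.inr hs)
          by_contra h
          exact hne (hT.eq_empty (i + 1) (by omega))
    · exact ih.of_zero_notMem hn hT h0 hk (fun j hj => by omega) hz h1

end Reachability

section Distinguish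
variable {k : ℕ} {n : ℕ → ℕ}

theorem letterAct_mem_tupleStep {S : ℕ → Finset ℕ} {i c y : ℕ} (hi : i < k) (hy : y ∈ S i) :
    letterAct (n i) i c y ∈ tupleStep k n S c i := by
  cases i with
  | zero => exact mem_tupleStep_zero.2 ⟨y, hy, rfl⟩
  | succ i => exact mem_tupleStep_succ.2 ⟨hi, Or.inl ⟨y, hy, rfl⟩⟩

theorem exists_of_mem_tupleStep {S : ℕ → Finset ℕ} {i c x : ℕ}
    (hx : x ∈ tupleStep k n S c i) (h0 : x ≠ 0) : ∃ y ∈ S i, letterAct (n i) i c y = x := by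
  cases i with
  | zero => exact mem_tupleStep_zero.1 hx
  | succ i => exact (mem_tupleStep_succ.1 hx).2.resolve_right fun h => h0 h.1

theorem exists_separating_word_last {i : ℕ} (hi : i < k) {S S' : ℕ → Finset ℕ} {s : ℕ}
    (hs : s < n i) (h : s ∈ S i) (h' : s ∉ S' i) :
    ∃ w, n i - 1 ∈ tupleRun k n S w i ∧ n i - 1 ∉ tupleRun k n S' w i := by
  obtain ⟨d, hd⟩ : ∃ d, s + d + 1 = n i := ⟨n i - 1 - s, by omega⟩
  induction d generalizing S S' s with
  | zero =>
    obtain rfl : s = n i - 1 := by omega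
    exact ⟨[], h, h'⟩
  | succ d ih =>
    have h1 : s + 1 ∈ tupleStep k n S (i + 1) i := by
      have := letterAct_mem_tupleStep (n := n) (c := i + 1) hi h
      rwa [letterAct, if_pos rfl, if_neg (by omega)] at this
    have h2 : s + 1 ∉ tupleStep k n S' (i + 1) i := by
      intro hx
      obtain ⟨y, hy, hys⟩ := exists_of_mem_tupleStep hx (by omega)
      rw [letterAct, if_pos rfl] at hys
      split_ifs at hys
      obtain rfl : y = s := by omega
      exact h' hy
    obtain ⟨w, hw⟩ := ih (by omega) h1 h2 (by omega)
    exact ⟨⟨i + 1, by omega⟩ :: w, hw⟩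

theorem exists_separating_word (hn : ∀ i, 3 ≤ n i) {i : ℕ} (hi : i < k) {S S' : ℕ → Finset ℕ}
    {s : ℕ} (hs : s < n i) (h : s ∈ S i) (h' : s ∉ S' i) :
    ∃ w, n (k - 1) - 1 ∈ tupleRun k n S w (k - 1) ∧
      n (k - 1) - 1 ∉ tupleRun k n S' w (k - 1) := by
  obtain ⟨d, hd⟩ : ∃ d, i + d + 1 = k := ⟨k - 1 - i, by omega⟩
  induction d generalizing i S S' s with
  | zero =>
    obtain rfl : i = k - 1 := by omega
    exact exists_separating_word_last hi hs h h'
  | succ d ih =>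
    obtain ⟨w, hw, hw'⟩ := exists_separating_word_last hi hs h h'
    have h3 := hn i
    have h1 : 0 ∈ tupleStep k n (tupleRun k n S w) 0 (i + 1) := by
      refine mem_tupleStep_succ.2 ⟨by omega, Or.inr ⟨rfl, ?_⟩⟩
      have := letterAct_mem_tupleStep (n := n) (c := 0) hi hw
      rwa [letterAct, if_neg (by omega), if_neg (by omega)] at this
    have h2 : 0 ∉ tupleStep k n (tupleRun k n S' w) 0 (i + 1) := by
      intro hx
      obtain ⟨_, ⟨y, _, hy⟩ | ⟨_, hx⟩⟩ := mem_tupleStep_succ.1 hx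
      · rw [letterAct, if_neg (by omega)] at hy
        split_ifs at hy
        omega
      · obtain ⟨y, hy, hyl⟩ := exists_of_mem_tupleStep hx (by omega)
        rw [letterAct, if_neg (by omega)] at hyl
        split_ifs at hyl
        · omega
        · exact hw' (hyl ▸ hy)
    obtain ⟨v, hv⟩ := ih (by omega) ((hn (i + 1)).trans_lt' (by norm_num)) h1 h2 (by omega)
    refine ⟨w ++ 0 :: v, ?_⟩
    rw [tupleRun, tupleRun, List.foldl_append, List.foldl_append]
    exact hv

end Distinguish

section Languages
variable {k : ℕ} {n : ℕ → ℕ}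

/-- The state of the `i`-th witness automaton with `m` states after reading a word. -/
def letterRun (k m i : ℕ) (w : List (Fin (k + 1))) : ℕ :=
  w.foldl (fun q c => letterAct m i c.val q) 0

theorem letterRun_append_singleton (m i : ℕ) (w : List (Fin (k + 1))) (c : Fin (k + 1)) :
    letterRun k m i (w ++ [c]) = letterAct m i c.val (letterRun k m i w) := by
  simp [letterRun]

/-- The language of the `i`-th witness automaton with `m` states. -/
def witnessLang (k m i : ℕ) : Language (Fin (k + 1)) := {w | letterRun k m i w = m - 1}

theorem mem_witnessLang {m i : ℕ} {w : List (Fin (k + 1))} :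
    w ∈ witnessLang k m i ↔ letterRun k m i w = m - 1 := Iff.rfl

/-- The concatenation of the first `i` witness languages. -/
def prefixLang (k : ℕ) (n : ℕ → ℕ) : ℕ → Language (Fin (k + 1))
  | 0 => 1
  | i + 1 => prefixLang k n i * witnessLang k (n i) i

theorem prefixLang_eq_prod (i : ℕ) :
    prefixLang k n i = (List.ofFn fun j : Fin i => witnessLang k (n j) j).prod := by
  induction i with
  | zero => simp [prefixLang]
  | succ i ih => rw [prefixLang, ih, List.ofFn_succ_last, List.prod_append]; simp

theorem nil_notMem_prefixLang_succ (hn : ∀ i, 3 ≤ n i) (i : ℕ) :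
    [] ∉ prefixLang k n (i + 1) := by
  rintro ⟨u, _, v, hv, h⟩
  obtain ⟨rfl, rfl⟩ := List.append_eq_nil_iff.1 h
  have h1 : 0 = n i - 1 := hv
  have := hn i
  omega

theorem mem_tupleRun_iff (hn : ∀ i, 3 ≤ n i) (w : List (Fin (k + 1))) {i : ℕ} (hi : i < k)
    (x : ℕ) : x ∈ tupleRun k n tupleStart w i ↔
      ∃ u v, u ∈ prefixLang k n i ∧ letterRun k (n i) i v = x ∧ u ++ v = w := by
  induction w using List.reverseRecOn generalizing i x with
  | nil =>
    cases i with
    | zero =>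
      simp [tupleRun, tupleStart, prefixLang, letterRun, eq_comm]
    | succ i =>
      simp only [List.append_eq_nil_iff]
      constructor
      · exact fun h => absurd h (Finset.notMem_empty x)
      · rintro ⟨u, v, hu, -, rfl, -⟩
        exact absurd hu (nil_notMem_prefixLang_succ hn i)
  | append_singleton w c ihw =>
    have hstep : tupleRun k n tupleStart (w ++ [c]) =
        tupleStep k n (tupleRun k n tupleStart w) c.val := by simp [tupleRun]
    induction i generalizing x with
    | zero =>
      rw [hstep, mem_tupleStep_zero]
      simp only [ihw hi, prefixLang, Language.mem_one]
      constructor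
      · rintro ⟨_, ⟨_, v, rfl, rfl, rfl⟩, rfl⟩
        exact ⟨[], v ++ [c], rfl, letterRun_append_singleton _ _ _ _, rfl⟩
      · rintro ⟨_, v, rfl, rfl, rfl⟩
        exact ⟨_, ⟨[], w, rfl, rfl, rfl⟩, (letterRun_append_singleton _ _ _ _).symm⟩
    | succ i ihi =>
      have hlast := ihi (by omega) (n i - 1)
      rw [hstep] at hlast
      rw [hstep, mem_tupleStep_succ]
      simp only [hi, true_and, ihw hi, hlast]
      constructor
      · rintro (⟨_, ⟨u, v, hu, rfl, rfl⟩, rfl⟩ | ⟨rfl, u, v, hu, hv, h⟩)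
        · exact ⟨u, v ++ [c], hu, letterRun_append_singleton _ _ _ _, by simp⟩
        · exact ⟨w ++ [c], [], ⟨u, hu, v, hv, h⟩, rfl, by simp⟩
      · rintro ⟨u, v, hu, rfl, h⟩
        rcases List.eq_nil_or_concat v with rfl | ⟨v, d, rfl⟩
        · obtain ⟨u₁, h₁, u₂, h₂, h₃⟩ := hu
          exact Or.inr ⟨rfl, u₁, u₂, h₁, h₂, h₃.trans ((List.append_nil u).symm.trans h)⟩
        · rw [List.concat_eq_append, ← List.append_assoc] at h
          obtain ⟨rfl, h⟩ := List.append_inj' h rfl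
          obtain rfl : d = c := by simpa using h
          exact Or.inl ⟨_, ⟨u, v, hu, rfl, rfl⟩, by
            rw [List.concat_eq_append, letterRun_append_singleton]⟩

theorem mem_prefixLang_iff (hn : ∀ i, 3 ≤ n i) (hk : 0 < k) (w : List (Fin (k + 1))) :
    w ∈ prefixLang k n k ↔ n (k - 1) - 1 ∈ tupleRun k n tupleStart w (k - 1) := by
  obtain ⟨p, rfl⟩ : ∃ p, k = p + 1 := ⟨k - 1, by omega⟩
  rw [mem_tupleRun_iff hn w (by omega)]
  constructor
  · rintro ⟨u, hu, v, hv, h⟩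
    exact ⟨u, v, hu, hv, h⟩
  · rintro ⟨u, v, hu, hv, h⟩
    exact ⟨u, hu, v, hv, h⟩

theorem witnessDFA_accepts {m : ℕ} (hm : 3 ≤ m) (i : Fin k) :
    (witnessDFA k hm i).accepts = witnessLang k m i := by
  have : NeZero m := ⟨by omega⟩
  have h : ∀ w, ((witnessDFA k hm i).eval w).val = letterRun k m i w := by
    intro w
    induction w using List.reverseRecOn with
    | nil => rfl
    | append_singleton w c ih =>
      rw [DFA.eval_append_singleton, letterRun_append_singleton, ← ih]
      generalize (witnessDFA k hm i).eval w = q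
      have hq := q.isLt
      simp only [witnessDFA, letterAct]
      split_ifs with h1 h2 h3
      · rw [Fin.val_add, Fin.val_one', Nat.mod_eq_of_lt (a := 1) (by omega), h2, Nat.mod_self]
      · rw [Fin.val_add, Fin.val_one', Nat.mod_eq_of_lt (a := 1) (by omega),
          Nat.mod_eq_of_lt (by omega)]
      · rfl
      · rfl
  ext w
  rw [DFA.mem_accepts, mem_witnessLang, ← h]
  exact Fin.ext_iff

theorem leftQuotient_prefixLang_eq_iff (hn : ∀ i, 3 ≤ n i) (hk : 0 < k)
    (w w' : List (Fin (k + 1))) :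
    (prefixLang k n k).leftQuotient w = (prefixLang k n k).leftQuotient w' ↔
      tupleRun k n tupleStart w = tupleRun k n tupleStart w' := by
  have happ : ∀ w v, w ++ v ∈ prefixLang k n k ↔
      n (k - 1) - 1 ∈ tupleRun k n (tupleRun k n tupleStart w) v (k - 1) := by
    intro w v
    rw [mem_prefixLang_iff hn hk, tupleRun, List.foldl_append]
    rfl
  have hsub : ∀ w w', (prefixLang k n k).leftQuotient w = (prefixLang k n k).leftQuotient w' →
      ∀ i, tupleRun k n tupleStart w i ⊆ tupleRun k n tupleStart w' i := by
    intro w w' h i s hs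
    by_contra hs'
    have hv := (tupleRun_start_valid hn hk w).1
    have hi : i < k := by
      by_contra hi
      simp [hv.eq_empty i (by omega)] at hs
    obtain ⟨v, h1, h2⟩ := exists_separating_word hn hi (hv.lt i s hs) hs hs'
    rw [← happ, ← Language.mem_leftQuotient] at h1 h2
    exact h2 (h ▸ h1)
  constructor
  · exact fun h => funext fun i => (hsub w w' h i).antisymm (hsub w' w h.symm i)
  · intro h
    ext v
    rw [Language.mem_leftQuotient, Language.mem_leftQuotient, happ, happ, h]

theorem ncard_range_leftQuotient_prefixLang (hn : ∀ i, 3 ≤ n i) :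
    (Set.range (prefixLang (k + 1) n (k + 1)).leftQuotient).Finite ∧
    (Set.range (prefixLang (k + 1) n (k + 1)).leftQuotient).ncard =
      Bval (n 0) (List.ofFn fun i : Fin k => n (i + 1)) := by
  have hmem : ∀ w, tupleRun (k + 1) n tupleStart w ∈ stateTuples k n :=
    fun w => mem_stateTuples.2 (tupleRun_start_valid hn k.succ_pos w)
  have hsurj : ∀ T ∈ stateTuples k n, ∃ w, tupleRun (k + 1) n tupleStart w = T := fun T hT =>
    (mem_stateTuples.1 hT).1.reachable hn k.succ_pos (mem_stateTuples.1 hT).2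
  choose! f hf using hsurj
  have himage : Set.range (prefixLang (k + 1) n (k + 1)).leftQuotient =
      (fun T => (prefixLang (k + 1) n (k + 1)).leftQuotient (f T)) '' (stateTuples k n : Set _) := by
    ext L
    constructor
    · rintro ⟨w, rfl⟩
      exact ⟨_, hmem w, (leftQuotient_prefixLang_eq_iff hn k.succ_pos _ _).2 (hf _ (hmem w))⟩
    · rintro ⟨T, _, rfl⟩
      exact ⟨_, rfl⟩
  rw [himage]
  refine ⟨(Finset.finite_toSet _).image _, ?_⟩
  rw [Set.InjOn.ncard_image, Set.ncard_coe_finset, card_stateTuples k n hn]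
  intro T hT T' hT' h
  rw [← hf T hT, ← hf T' hT']
  exact (leftQuotient_prefixLang_eq_iff hn k.succ_pos _ _).1 h

end Languages

theorem DFA.ncard_range_leftQuotient_le {α Q : Type*} [Fintype Q] (D : DFA α Q) :
    (Set.range D.accepts.leftQuotient).ncard ≤ Fintype.card Q := by
  rw [Language.leftQuotient_accepts, ← Nat.card_eq_fintype_card, ← Set.ncard_univ]
  refine (Set.ncard_le_ncard (t := D.acceptsFrom '' Set.univ) ?_ (Set.toFinite _)).trans
    (Set.ncard_image_le Set.finite_univ)
  rintro _ ⟨w, rfl⟩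
  exact ⟨_, trivial, rfl⟩

/-- For `k ≥ 2` and `nᵢ ≥ 3`, the minimal DFA for the concatenation
`L(A₁)⋯L(A_k)` of the witness languages has exactly `B(n₁,…,n_k)` states. -/
theorem stmt8 (k : ℕ) (hk : 2 ≤ k) (n : Fin k → ℕ) (hn : ∀ i, 3 ≤ n i) :
    (∃ (Q : Type) (_ : Fintype Q) (D : DFA (Fin (k + 1)) Q),
      D.accepts = (List.ofFn fun i => (witnessDFA k (hn i) i).accepts).prod ∧
      Fintype.card Q =
        Bval (n ⟨0, Nat.lt_of_lt_of_le Nat.zero_lt_two hk⟩) ((List.ofFn n).drop 1)) ∧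
    (∀ (Q : Type) (inst : Fintype Q) (D : DFA (Fin (k + 1)) Q),
      D.accepts = (List.ofFn fun i => (witnessDFA k (hn i) i).accepts).prod →
      Bval (n ⟨0, Nat.lt_of_lt_of_le Nat.zero_lt_two hk⟩) ((List.ofFn n).drop 1)
        ≤ @Fintype.card Q inst) := by
  obtain ⟨k, rfl⟩ : ∃ p, k = p + 1 := ⟨k - 1, by omega⟩
  obtain ⟨N, hN, hNn⟩ : ∃ N : ℕ → ℕ, (∀ i, 3 ≤ N i) ∧ ∀ i : Fin (k + 1), N i = n i := by
    refine ⟨fun i => if h : i < k + 1 then n ⟨i, h⟩ else 3, fun i => ?_, fun i => dif_pos i.isLt⟩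
    dsimp only
    split_ifs
    exacts [hn _, le_rfl]
  obtain ⟨hfin, hcard⟩ := ncard_range_leftQuotient_prefixLang (k := k) hN
  have hL : (List.ofFn fun i => (witnessDFA (k + 1) (hn i) i).accepts).prod =
      prefixLang (k + 1) N (k + 1) := by
    simp only [prefixLang_eq_prod, witnessDFA_accepts, hNn]
  have hB : Bval (n ⟨0, Nat.lt_of_lt_of_le Nat.zero_lt_two hk⟩) ((List.ofFn n).drop 1) =
      Bval (N 0) (List.ofFn fun i : Fin k => N (i + 1)) := by
    rw [List.ofFn_succ, List.drop_one, List.tail_cons]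
    congr 1
    · exact (hNn 0).symm
    · congr 1
      funext i
      exact (hNn i.succ).symm
  rw [hL, hB, ← hcard]
  refine ⟨⟨_, hfin.fintype, Language.toDFA _, Language.accepts_toDFA _, ?_⟩, ?_⟩
  · let := hfin.fintype
    exact Nat.card_eq_fintype_card.symm
  · intro Q _ D hD
    rw [← hD]
    exact D.ncard_range_leftQuotient_le
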